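/- Every universe is populated: for every integer N ≥ 1 and every integer m, N · dim_ℂ eigenspace(P_σ, exp(2πi m/N)) ≥ 2^{N−1} − ∑_{p odd prime, p ∣ N} 2^{N/p − 1}. (Physically: each of the N universes of massless adjoint QCD contains at least 2^{N−1}/N + O(2^{N/3}) degenerate vacua, implying complete deconfinement.) -/

import Mathlib

/-- An admissible `N`-tuple: `λ : Fin N → ℕ` with `∑ (λᵢ + 1) = 2N` and every consecutive
sum `∑_{k=i}^{j} (λₖ + 1) ≠ N` for `i ≤ j`. -/
def Admissible (N : ℕ) (lam : Fin N → ℕ) : Prop :=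
  (∑ i, (lam i + 1)) = 2 * N ∧
  ∀ i j : Fin N, i ≤ j → (∑ k ∈ Finset.Icc i j, (lam k + 1)) ≠ N

/-- The cyclic shift `(σλ)_k = λ_{(k+1) mod N}`. -/
def shift (N : ℕ) (lam : Fin N → ℕ) : Fin N → ℕ :=
  fun k => lam ⟨((k : ℕ) + 1) % N, Nat.mod_lt _ (Nat.zero_lt_of_lt k.isLt)⟩

open Finset Function

section PermutationEigenspace

variable {X : Type*} [Fintype X]

/-- The `N`-step average of `f` along the orbits of `σ`, twisted by the powers of `ω⁻¹`. For
`σ^[N] = id` and `ω ^ N = 1` this is the projection onto the `ω`-eigenspace of `f ↦ f ∘ σ`. -/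
noncomputable def twistedAverage (σ : X → X) (N : ℕ) (ω : ℂ) : (X → ℂ) →ₗ[ℂ] (X → ℂ) :=
  (N : ℂ)⁻¹ • ∑ k ∈ range N, (ω⁻¹) ^ k • LinearMap.funLeft ℂ ℂ (σ^[k])

omit [Fintype X] in
lemma twistedAverage_apply (σ : X → X) (N : ℕ) (ω : ℂ) (f : X → ℂ) (x : X) :
    twistedAverage σ N ω f x = (N : ℂ)⁻¹ * ∑ k ∈ range N, (ω⁻¹) ^ k * f (σ^[k] x) := by
  simp [twistedAverage, LinearMap.sum_apply, Finset.sum_apply, LinearMap.funLeft_apply]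

omit [Fintype X] in
lemma mem_eigenspace_funLeft_iff (σ : X → X) (ω : ℂ) (f : X → ℂ) :
    f ∈ Module.End.eigenspace (LinearMap.funLeft ℂ ℂ σ) ω ↔ ∀ x, f (σ x) = ω * f x := by
  rw [Module.End.mem_eigenspace_iff, funext_iff]
  simp [LinearMap.funLeft_apply]

omit [Fintype X] in
lemma isProj_twistedAverage (σ : X → X) {N : ℕ} (hN : N ≠ 0) (hσ : σ^[N] = id) {ω : ℂ}
    (hω : ω ^ N = 1) :
    LinearMap.IsProj (Module.End.eigenspace (LinearMap.funLeft ℂ ℂ σ) ω)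
      (twistedAverage σ N ω) := by
  have hω0 : ω ≠ 0 := by
    rintro rfl
    simp [hN] at hω
  have hNC : (N : ℂ) ≠ 0 := by exact_mod_cast hN
  refine ⟨fun f => ?_, fun f hf => ?_⟩
  · rw [mem_eigenspace_funLeft_iff]
    intro x
    rw [twistedAverage_apply, twistedAverage_apply, mul_left_comm]
    congr 1
    have h := (sum_range_succ' (fun k => (ω⁻¹) ^ k * f (σ^[k] x)) N).symm.trans
      (sum_range_succ (fun k => (ω⁻¹) ^ k * f (σ^[k] x)) N)
    have hper : (ω⁻¹) ^ N * f (σ^[N] x) = (ω⁻¹) ^ 0 * f (σ^[0] x) := by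
      simp [hσ, hω]
    rw [hper] at h
    rw [← add_right_cancel h, mul_sum]
    refine sum_congr rfl fun k _ => ?_
    rw [iterate_succ_apply, pow_succ]
    field_simp
  · rw [mem_eigenspace_funLeft_iff] at hf
    have hit : ∀ k x, f (σ^[k] x) = ω ^ k * f x := by
      intro k
      induction k with
      | zero => simp
      | succ k ih =>
        intro x
        rw [iterate_succ_apply, ih, hf]
        ring
    ext x
    rw [twistedAverage_apply]
    have : ∀ k ∈ range N, (ω⁻¹) ^ k * f (σ^[k] x) = f x := by
      intro k _
      rw [hit, ← mul_assoc, ← mul_pow, inv_mul_cancel₀ hω0, one_pow, one_mul]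
    rw [sum_congr rfl this]
    simp [hNC]

lemma trace_twistedAverage [DecidableEq X] (σ : X → X) (N : ℕ) (ω : ℂ) :
    LinearMap.trace ℂ (X → ℂ) (twistedAverage σ N ω) =
      (N : ℂ)⁻¹ * ∑ x, ∑ k ∈ range N with σ^[k] x = x, (ω⁻¹) ^ k := by
  rw [LinearMap.trace_eq_matrix_trace ℂ (Pi.basisFun ℂ X), Matrix.trace, mul_sum]
  refine sum_congr rfl fun x _ => ?_
  rw [Matrix.diag_apply, LinearMap.toMatrix_apply]
  simp only [Pi.basisFun_apply, Pi.basisFun_repr, twistedAverage_apply]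
  congr 1
  rw [sum_filter]
  refine sum_congr rfl fun k _ => ?_
  simp [Pi.single_apply]

omit [Fintype X] in
/-- The powers of a root of unity along the return times of a periodic point add up to a natural
number. -/
lemma exists_nat_sum_returnTimes [DecidableEq X] (σ : X → X) {N : ℕ} (hN : N ≠ 0)
    (hσ : σ^[N] = id) {z : ℂ} (hz : z ^ N = 1) (x : X) :
    ∃ c : ℕ, ∑ k ∈ range N with σ^[k] x = x, z ^ k = c := by
  obtain ⟨e, he⟩ : minimalPeriod σ x ∣ N :=
    IsPeriodicPt.minimalPeriod_dvd (by simp [IsPeriodicPt, IsFixedPt, hσ])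
  set d := minimalPeriod σ x
  have hd : 0 < d := Nat.pos_of_ne_zero (by rintro h; simp [h] at he; omega)
  have himg : (range N).filter (fun k => σ^[k] x = x) = (range e).image (d * ·) := by
    ext k
    have hiff : σ^[k] x = x ↔ d ∣ k := isPeriodicPt_iff_minimalPeriod_dvd
    simp only [mem_filter, mem_range, mem_image, hiff]
    constructor
    · rintro ⟨hk, j, rfl⟩
      exact ⟨j, by rw [he] at hk; exact lt_of_mul_lt_mul_left hk (Nat.zero_le _), rfl⟩
    · rintro ⟨j, hj, rfl⟩
      exact ⟨by rw [he]; exact Nat.mul_lt_mul_of_pos_left hj hd, dvd_mul_right _ _⟩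
  rw [himg, sum_image fun a _ b _ h => Nat.eq_of_mul_eq_mul_left hd h]
  simp only [pow_mul]
  by_cases h1 : z ^ d = 1
  · exact ⟨e, by simp [h1]⟩
  · refine ⟨0, ?_⟩
    rw [geom_sum_eq h1, ← pow_mul, ← he, hz]
    simp

/-- If `σ` has order dividing `N`, each eigenspace of `f ↦ f ∘ σ` at an `N`-th root of unity has
dimension at least the number of free orbits. -/
theorem card_free_le_mul_finrank_eigenspace (σ : X → X) {N : ℕ} (hN : N ≠ 0)
    (hσ : σ^[N] = id) {ω : ℂ} (hω : ω ^ N = 1) {F : Finset X}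
    (hF : ∀ x ∈ F, ∀ k ∈ Ioo 0 N, σ^[k] x ≠ x) :
    #F ≤ N * Module.finrank ℂ (Module.End.eigenspace (LinearMap.funLeft ℂ ℂ σ) ω) := by
  classical
  have hNC : (N : ℂ) ≠ 0 := by exact_mod_cast hN
  have htr := (isProj_twistedAverage σ hN hσ hω).trace
  rw [trace_twistedAverage, inv_mul_eq_iff_eq_mul₀ hNC] at htr
  choose c hc using exists_nat_sum_returnTimes σ hN hσ (z := ω⁻¹) (by simp [hω])
  simp only [hc] at htr
  have hsum : ∑ x, c x =
      N * Module.finrank ℂ (Module.End.eigenspace (LinearMap.funLeft ℂ ℂ σ) ω) := by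
    exact_mod_cast htr
  have hone : ∀ x ∈ F, 1 ≤ c x := by
    intro x hx
    have himg : (range N).filter (fun k => σ^[k] x = x) = {0} := by
      ext k
      simp only [mem_filter, mem_range, mem_singleton]
      refine ⟨fun ⟨hk, h⟩ => ?_, ?_⟩
      · by_contra h0
        exact hF x hx k (mem_Ioo.2 ⟨by omega, hk⟩) h
      · rintro rfl
        exact ⟨by omega, rfl⟩
    have := hc x
    rw [himg] at this
    simp only [sum_singleton, pow_zero] at this
    have h1 : c x = 1 := by exact_mod_cast this.symm
    exact h1.ge
  calc #F ≤ ∑ x ∈ F, c x := by simpa using card_nsmul_le_sum F c 1 hone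
    _ ≤ ∑ x, c x := sum_le_sum_of_subset (subset_univ F)
    _ = _ := hsum

end PermutationEigenspace

/-- The `N`-periodic extension of a tuple to `ℕ`. -/
def cyc {N : ℕ} (hN : 0 < N) (lam : Fin N → ℕ) (k : ℕ) : ℕ :=
  lam ⟨k % N, Nat.mod_lt _ hN⟩

/-- Partial sums of the sequence `a + 1`. -/
def psum (a : ℕ → ℕ) (n : ℕ) : ℕ :=
  ∑ k ∈ range n, (a k + 1)

@[simp] lemma psum_zero (a : ℕ → ℕ) : psum a 0 = 0 := rfl

lemma psum_succ (a : ℕ → ℕ) (n : ℕ) : psum a (n + 1) = psum a n + (a n + 1) :=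
  sum_range_succ _ _

lemma psum_strictMono (a : ℕ → ℕ) : StrictMono (psum a) :=
  strictMono_nat_of_lt_succ fun n => by rw [psum_succ]; omega

lemma psum_congr {a b : ℕ → ℕ} {n : ℕ} (h : ∀ k < n, a k = b k) : psum a n = psum b n :=
  sum_congr rfl fun k hk => by rw [h k (mem_range.1 hk)]

lemma psum_add_mul {a : ℕ → ℕ} {M : ℕ} (ha : ∀ k, a (k + M) = a k) (n q : ℕ) :
    psum a (n + q * M) = psum a n + q * psum a M := by
  have hstep : ∀ n, psum a (n + M) = psum a n + psum a M := by
    intro n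
    induction n with
    | zero => simp
    | succ n ih => rw [add_right_comm, psum_succ, psum_succ, ih, ha]; ring
  induction q with
  | zero => simp
  | succ q ih => rw [add_mul, one_mul, ← add_assoc, hstep, ih]; ring

section Tuples

variable {N : ℕ} (hN : 0 < N)

lemma cyc_of_lt (lam : Fin N → ℕ) {k : ℕ} (hk : k < N) : cyc hN lam k = lam ⟨k, hk⟩ := by
  simp [cyc, Nat.mod_eq_of_lt hk]

lemma cyc_injective : Injective (cyc hN) := by
  intro a b h
  ext ⟨k, hk⟩
  rw [← cyc_of_lt hN a hk, ← cyc_of_lt hN b hk, h]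

lemma cyc_shift (lam : Fin N → ℕ) (k : ℕ) : cyc hN (shift N lam) k = cyc hN lam (k + 1) := by
  simp [cyc, shift]

lemma sum_Icc_add_psum (lam : Fin N → ℕ) (i j : Fin N) (hij : i ≤ j) :
    (∑ k ∈ Icc i j, (lam k + 1)) + psum (cyc hN lam) i = psum (cyc hN lam) (j + 1) := by
  have h : ∑ k ∈ Icc i j, (lam k + 1) = ∑ k ∈ Ico (i : ℕ) (j + 1), (cyc hN lam k + 1) := by
    have : Ico (i : ℕ) (j + 1) = (Icc i j).map Fin.valEmbedding := by
      rw [Fin.map_valEmbedding_Icc]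
      ext k
      simp only [mem_Ico, mem_Icc]
      omega
    rw [this, sum_map]
    exact sum_congr rfl fun k _ => by simp [cyc_of_lt hN lam k.isLt]
  rw [h, add_comm]
  exact sum_range_add_sum_Ico _ (by have : (i : ℕ) ≤ j := hij; omega)

lemma admissible_iff (lam : Fin N → ℕ) :
    Admissible N lam ↔ psum (cyc hN lam) N = 2 * N ∧
      ∀ i j, i < j → j ≤ N → psum (cyc hN lam) j ≠ psum (cyc hN lam) i + N := by
  have htot : ∑ i, (lam i + 1) = psum (cyc hN lam) N := by
    rw [psum, ← Fin.sum_univ_eq_sum_range (fun k => cyc hN lam k + 1) N]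
    exact sum_congr rfl fun k _ => by simp [cyc_of_lt hN lam k.isLt]
  rw [Admissible, htot]
  refine and_congr_right fun _ => ⟨fun h i j hij hj he => ?_, fun h i j hij he => ?_⟩
  · have hle : (⟨i, by omega⟩ : Fin N) ≤ ⟨j - 1, by omega⟩ := by
      simp only [Fin.mk_le_mk]; omega
    refine h _ _ hle ?_
    have := sum_Icc_add_psum hN lam _ _ hle
    simp only [Nat.sub_add_cancel (show 1 ≤ j by omega)] at this
    omega
  · have := sum_Icc_add_psum hN lam i j hij
    have hij' : (i : ℕ) ≤ j := hij
    exact h i (j + 1) (by omega) (by omega) (by omega)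

/-- The proper partial sums of a tuple. -/
def sumSet (lam : Fin N → ℕ) : Finset ℕ :=
  (range N).image (psum (cyc hN lam))

lemma zero_mem_sumSet (lam : Fin N → ℕ) : 0 ∈ sumSet hN lam :=
  mem_image.2 ⟨0, mem_range.2 hN, rfl⟩

variable {hN}

lemma lt_of_mem_sumSet {lam : Fin N → ℕ} (h : Admissible N lam) {x : ℕ}
    (hx : x ∈ sumSet hN lam) : x < 2 * N := by
  obtain ⟨i, hi, rfl⟩ := mem_image.1 hx
  rw [← ((admissible_iff hN lam).1 h).1]
  exact psum_strictMono _ (mem_range.1 hi)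

lemma add_notMem_sumSet {lam : Fin N → ℕ} (h : Admissible N lam) {x : ℕ}
    (hx : x ∈ sumSet hN lam) : x + N ∉ sumSet hN lam := by
  intro hy
  obtain ⟨i, hi, rfl⟩ := mem_image.1 hx
  obtain ⟨j, hj, he⟩ := mem_image.1 hy
  refine ((admissible_iff hN lam).1 h).2 i j ?_ (mem_range.1 hj).le he
  rw [← (psum_strictMono (cyc hN lam)).lt_iff_lt]
  omega

/-- The partial sums of an admissible tuple contain exactly one of `x` and `x + N`. -/
lemma add_mem_sumSet_iff {lam : Fin N → ℕ} (h : Admissible N lam) {x : ℕ} (hx : x < N) :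
    x + N ∈ sumSet hN lam ↔ x ∉ sumSet hN lam := by
  refine ⟨fun hy hx' => add_notMem_sumSet h hx' hy, fun hx' => ?_⟩
  have hcard : #(sumSet hN lam) = N := by
    rw [sumSet, card_image_of_injective _ (psum_strictMono _).injective, card_range]
  have hinj : Set.InjOn (· % N) (sumSet hN lam : Set ℕ) := by
    intro a ha b hb hab
    have ha2 := lt_of_mem_sumSet h ha
    have hb2 := lt_of_mem_sumSet h hb
    have key : ∀ c, c < 2 * N → c % N = c ∨ c = c % N + N := by
      intro c hc
      rcases lt_or_ge c N with h | h
      · exact Or.inl (Nat.mod_eq_of_lt h)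
      · rw [Nat.mod_eq_sub_mod h, Nat.mod_eq_of_lt (by omega)]
        omega
    simp only at hab
    rcases key a ha2 with h1 | h1 <;> rcases key b hb2 with h2 | h2
    · omega
    · exact absurd (show a + N ∈ sumSet hN lam by rwa [← h1, hab, ← h2])
        (add_notMem_sumSet h ha)
    · exact absurd (show b + N ∈ sumSet hN lam by rwa [← h2, ← hab, ← h1])
        (add_notMem_sumSet h hb)
    · omega
  have himg : (sumSet hN lam).image (· % N) = range N := by
    refine eq_of_subset_of_card_le ?_ (by rw [card_image_of_injOn hinj, hcard, card_range])
    intro y hy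
    obtain ⟨z, _, rfl⟩ := mem_image.1 hy
    exact mem_range.2 (Nat.mod_lt _ hN)
  obtain ⟨z, hz, hzx⟩ := mem_image.1 (himg ▸ mem_range.2 hx)
  have hz2 := lt_of_mem_sumSet h hz
  rcases lt_or_ge z N with hlt | hge
  · rw [Nat.mod_eq_of_lt hlt] at hzx
    exact absurd (hzx ▸ hz) hx'
  · rw [Nat.mod_eq_sub_mod hge, Nat.mod_eq_of_lt (by omega)] at hzx
    rwa [← hzx, Nat.sub_add_cancel hge]

lemma eq_of_sumSet_eq {a b : Fin N → ℕ} (ha : Admissible N a) (hb : Admissible N b)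
    (h : sumSet hN a = sumSet hN b) : a = b := by
  have hP : ∀ n ≤ N, psum (cyc hN a) n = psum (cyc hN b) n := by
    intro n hn
    rcases hn.lt_or_eq with hlt | rfl
    · have hm : ∀ c : Fin N → ℕ, StrictMono fun i : Fin N => psum (cyc hN c) i :=
        fun c i j hij => psum_strictMono _ hij
      have hr : ∀ c : Fin N → ℕ,
          Set.range (fun i : Fin N => psum (cyc hN c) i) = (sumSet hN c : Set ℕ) := by
        intro c
        ext x
        simp [sumSet, Fin.exists_iff]
      exact congrFun (((hm a).range_inj (hm b)).1 (by rw [hr, hr, h])) ⟨n, hlt⟩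
    · rw [((admissible_iff hN a).1 ha).1, ((admissible_iff hN b).1 hb).1]
  ext ⟨k, hk⟩
  have h1 := hP (k + 1) hk
  rw [psum_succ, psum_succ, hP k hk.le, cyc_of_lt hN a hk, cyc_of_lt hN b hk] at h1
  omega

variable (hN)

lemma injective_sumSet_inter :
    Injective fun l : {lam : Fin N → ℕ // Admissible N lam} =>
      (Ioo 0 N).filter (· ∈ sumSet hN l.1) := by
  rintro ⟨a, ha⟩ ⟨b, hb⟩ h
  simp only [Finset.ext_iff, mem_filter, mem_Ioo] at h
  have hlow : ∀ x < N, (x ∈ sumSet hN a ↔ x ∈ sumSet hN b) := by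
    intro x hx
    rcases Nat.eq_zero_or_pos x with rfl | h0
    · simp [zero_mem_sumSet]
    · simpa [h0, hx] using h x
  refine Subtype.ext (eq_of_sumSet_eq (hN := hN) ha hb ?_)
  ext x
  rcases lt_or_ge x N with hx | hx
  · exact hlow x hx
  · rcases lt_or_ge x (2 * N) with hx2 | hx2
    · obtain ⟨y, rfl⟩ := Nat.exists_eq_add_of_le' hx
      rw [add_mem_sumSet_iff ha (by omega), add_mem_sumSet_iff hb (by omega),
        hlow y (by omega)]
    · exact iff_of_false (fun hm => absurd (lt_of_mem_sumSet ha hm) (by omega))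
        (fun hm => absurd (lt_of_mem_sumSet hb hm) (by omega))

/-- A set of `N` naturals below `2N` containing `0` is the set of partial sums of a tuple. -/
lemma exists_tuple_of_finset {U : Finset ℕ} (hcard : #U = N) (h0 : 0 ∈ U)
    (hlt : ∀ x ∈ U, x < 2 * N) :
    ∃ lam : Fin N → ℕ, psum (cyc hN lam) N = 2 * N ∧ sumSet hN lam = U := by
  set e := U.orderEmbOfFin hcard with he
  set E : ℕ → ℕ := fun k => if h : k < N then e ⟨k, h⟩ else 2 * N with hE
  have hmem : ∀ i, e i ∈ U := orderEmbOfFin_mem U hcard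
  have hrange : ∀ x ∈ U, ∃ i, e i = x := by
    intro x hx
    have : x ∈ Set.range e := by rw [he, range_orderEmbOfFin]; exact hx
    exact this
  have hElt : ∀ {k} (hk : k < N), E k = e ⟨k, hk⟩ := fun hk => by simp [hE, hk]
  have hEN : E N = 2 * N := by simp [hE]
  have hE0 : E 0 = 0 := by
    obtain ⟨i, hi⟩ := hrange 0 h0
    have : e ⟨0, hN⟩ ≤ e i := e.monotone (Fin.mk_le_of_le_val (Nat.zero_le _))
    rw [hElt hN]
    omega
  have hstep : ∀ k < N, E k < E (k + 1) := by
    intro k hk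
    rcases Nat.lt_or_ge (k + 1) N with hk1 | hk1
    · rw [hElt hk, hElt hk1]
      exact e.strictMono (Fin.mk_lt_mk.2 (Nat.lt_succ_self k))
    · rw [hElt hk, show k + 1 = N by omega, hEN]
      exact hlt _ (hmem _)
  refine ⟨fun k => E (k + 1) - E k - 1, ?_⟩
  set lam : Fin N → ℕ := fun k => E (k + 1) - E k - 1
  have hP : ∀ n ≤ N, psum (cyc hN lam) n = E n := by
    intro n
    induction n with
    | zero => intro _; rw [psum_zero, hE0]
    | succ n ih =>
      intro hn
      have := hstep n hn
      rw [psum_succ, ih (by omega), cyc_of_lt hN lam hn]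
      simp only [lam]
      omega
  refine ⟨by rw [hP N le_rfl, hEN], ?_⟩
  ext x
  simp only [sumSet, mem_image, mem_range]
  constructor
  · rintro ⟨n, hn, rfl⟩
    rw [hP n hn.le, hElt hn]
    exact hmem _
  · intro hx
    obtain ⟨⟨i, hi⟩, rfl⟩ := hrange x hx
    exact ⟨i, hi, by rw [hP i hi.le, hElt hi]⟩

lemma surjOn_sumSet_inter {A : Finset ℕ} (hA : A ⊆ Ioo 0 N) :
    ∃ l : {lam : Fin N → ℕ // Admissible N lam}, (Ioo 0 N).filter (· ∈ sumSet hN l.1) = A := by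
  set g : ℕ → ℕ := fun x => if x = 0 ∨ x ∈ A then x else x + N with hg
  have hgcases : ∀ x, ((x = 0 ∨ x ∈ A) ∧ g x = x) ∨ (¬ (x = 0 ∨ x ∈ A) ∧ g x = x + N) := by
    intro x
    by_cases h : x = 0 ∨ x ∈ A
    · exact Or.inl ⟨h, if_pos h⟩
    · exact Or.inr ⟨h, if_neg h⟩
  have hinj : Set.InjOn g (range N : Set ℕ) := by
    intro a ha b hb hab
    simp only [coe_range, Set.mem_Iio] at ha hb
    rcases hgcases a with ⟨_, h1⟩ | ⟨_, h1⟩ <;> rcases hgcases b with ⟨_, h2⟩ | ⟨_, h2⟩ <;> omega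
  obtain ⟨lam, hsum, hU⟩ := exists_tuple_of_finset hN (U := (range N).image g)
    (by rw [card_image_of_injOn hinj, card_range])
    (mem_image.2 ⟨0, mem_range.2 hN, by simp [hg]⟩)
    (by
      intro x hx
      obtain ⟨y, hy, rfl⟩ := mem_image.1 hx
      rw [mem_range] at hy
      rcases hgcases y with ⟨_, h1⟩ | ⟨_, h1⟩ <;> omega)
  have hadm : Admissible N lam := by
    refine (admissible_iff hN lam).2 ⟨hsum, fun i j hij hj he => ?_⟩
    rcases hj.lt_or_eq with hj | rfl
    · have hi' : psum (cyc hN lam) i ∈ (range N).image g :=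
        hU ▸ mem_image.2 ⟨i, mem_range.2 (hij.trans hj), rfl⟩
      have hj' : psum (cyc hN lam) j ∈ (range N).image g :=
        hU ▸ mem_image.2 ⟨j, mem_range.2 hj, rfl⟩
      obtain ⟨x, hx, hxe⟩ := mem_image.1 hi'
      obtain ⟨y, hy, hye⟩ := mem_image.1 hj'
      rw [mem_range] at hx hy
      rcases hgcases x with ⟨hx0, h1⟩ | ⟨hx0, h1⟩ <;> rcases hgcases y with ⟨hy0, h2⟩ | ⟨hy0, h2⟩
      · omega
      · exact hy0 ((show x = y by omega) ▸ hx0)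
      · omega
      · omega
    · have hi' : j ∈ (range j).image g :=
        hU ▸ mem_image.2 ⟨i, mem_range.2 hij, by omega⟩
      obtain ⟨x, hx, hxe⟩ := mem_image.1 hi'
      rw [mem_range] at hx
      rcases hgcases x with ⟨hx0, h1⟩ | ⟨hx0, h1⟩
      · omega
      · exact hx0 (Or.inl (by omega))
  refine ⟨⟨lam, hadm⟩, ?_⟩
  ext x
  simp only [mem_filter, mem_Ioo, hU, mem_image, mem_range]
  constructor
  · rintro ⟨⟨h0, hx⟩, y, hy, rfl⟩
    rcases hgcases y with ⟨hy0, h1⟩ | ⟨_, h1⟩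
    · rw [h1] at h0 ⊢
      exact hy0.resolve_left h0.ne'
    · omega
  · intro hx
    have := mem_Ioo.1 (hA hx)
    exact ⟨this, x, this.2, if_pos (Or.inr hx)⟩

/-- Admissible tuples correspond to subsets of `{1, …, N - 1}`. -/
noncomputable def admissibleEquiv :
    {lam : Fin N → ℕ // Admissible N lam} ≃ (Ioo 0 N).powerset :=
  Equiv.ofBijective
    (fun l => ⟨(Ioo 0 N).filter (· ∈ sumSet hN l.1), mem_powerset.2 (filter_subset _ _)⟩)
    ⟨fun _ _ h => injective_sumSet_inter hN (congrArg Subtype.val h), fun ⟨_, hA⟩ =>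
      (surjOn_sumSet_inter hN (mem_powerset.1 hA)).imp fun _ h => Subtype.ext h⟩

include hN in
lemma finite_admissible : Finite {lam : Fin N → ℕ // Admissible N lam} :=
  Finite.of_equiv _ (admissibleEquiv hN).symm

include hN in
lemma card_admissible : Nat.card {lam : Fin N → ℕ // Admissible N lam} = 2 ^ (N - 1) := by
  rw [Nat.card_congr (admissibleEquiv hN), Nat.card_eq_fintype_card, Fintype.card_coe,
    card_powerset, Nat.card_Ioo, Nat.sub_zero]

variable {hN}

lemma psum_period {lam : Fin N → ℕ} (h : Admissible N lam) {p M : ℕ} (hp : 0 < p)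
    (hNp : N = p * M) (hper : ∀ k, cyc hN lam (k + M) = cyc hN lam k) :
    psum (cyc hN lam) M = 2 * M := by
  have h1 := psum_add_mul hper 0 p
  rw [zero_add, ← hNp, ((admissible_iff hN lam).1 h).1, psum_zero, zero_add] at h1
  refine Nat.eq_of_mul_eq_mul_left hp ?_
  rw [← h1]
  linarith

lemma not_periodic_half {lam : Fin N → ℕ} (h : Admissible N lam) {M : ℕ} (hNM : N = 2 * M) :
    ¬ ∀ k, cyc hN lam (k + M) = cyc hN lam k := by
  intro hper
  have := psum_period h two_pos hNM hper
  exact ((admissible_iff hN lam).1 h).2 0 M (by omega) (by omega) (by rw [this, psum_zero]; omega)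

lemma admissible_restrict {lam : Fin N → ℕ} (h : Admissible N lam) {p M : ℕ} (hp : Odd p)
    (hM : 0 < M) (hNp : N = p * M) (hper : ∀ k, cyc hN lam (k + M) = cyc hN lam k) :
    Admissible M fun k => cyc hN lam k := by
  have hcyc : ∀ n ≤ M, psum (cyc hM fun k => cyc hN lam k) n = psum (cyc hN lam) n :=
    fun n hn => psum_congr fun k hk => by rw [cyc_of_lt hM _ (hk.trans_le hn)]
  have htot := psum_period h hp.pos hNp hper
  refine (admissible_iff hM _).2 ⟨by rw [hcyc M le_rfl, htot], fun i j hij hj he => ?_⟩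
  rw [hcyc j hj, hcyc i (by omega)] at he
  obtain ⟨q, rfl⟩ := hp
  have hN' : N = 2 * (q * M) + M := by rw [hNp]; ring
  refine ((admissible_iff hN lam).1 h).2 i (j + q * M) (by omega) (by omega) ?_
  rw [psum_add_mul hper, he, htot]
  linarith

lemma cyc_restrict_injective {M : ℕ} (hM : 0 < M) {a b : Fin N → ℕ}
    (ha : ∀ k, cyc hN a (k + M) = cyc hN a k) (hb : ∀ k, cyc hN b (k + M) = cyc hN b k)
    (h : (fun k : Fin M => cyc hN a k) = fun k : Fin M => cyc hN b k) : a = b := by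
  refine cyc_injective hN (funext fun k => ?_)
  have hmod : ∀ c : Fin N → ℕ, (∀ k, cyc hN c (k + M) = cyc hN c k) →
      cyc hN c k = cyc hN c (k % M) := fun c hc => (Periodic.map_mod_nat hc k).symm
  rw [hmod a ha, hmod b hb]
  exact congrFun h ⟨k % M, Nat.mod_lt _ hM⟩

end Tuples

section Shift

variable {N : ℕ} (hN : 0 < N)
  {σ : {lam : Fin N → ℕ // Admissible N lam} → {lam : Fin N → ℕ // Admissible N lam}}
  (hσ : ∀ l, (σ l : Fin N → ℕ) = shift N l)

include hσ

lemma cyc_iterate (n : ℕ) (l : {lam : Fin N → ℕ // Admissible N lam}) (k : ℕ) :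
    cyc hN (σ^[n] l).1 k = cyc hN l.1 (k + n) := by
  induction n generalizing k with
  | zero => rfl
  | succ n ih => rw [iterate_succ_apply', hσ, cyc_shift, ih, add_right_comm, add_assoc]

include hN in
lemma iterate_shift_eq_id : σ^[N] = id := by
  funext l
  refine Subtype.ext (cyc_injective hN (funext fun k => ?_))
  rw [cyc_iterate hN hσ]
  simp [cyc]

lemma cyc_periodic_of_iterate_eq {n : ℕ} {l : {lam : Fin N → ℕ // Admissible N lam}}
    (h : σ^[n] l = l) (k : ℕ) : cyc hN l.1 (k + n) = cyc hN l.1 k := by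
  rw [← cyc_iterate hN hσ, h]

include hN in
lemma card_fixed_le {p M : ℕ} (hp : Odd p) (hNp : N = p * M) :
    Nat.card {l // σ^[M] l = l} ≤ 2 ^ (M - 1) := by
  have hM : 0 < M := Nat.pos_of_ne_zero (by rintro rfl; omega)
  have := finite_admissible hM
  rw [← card_admissible hM]
  refine Nat.card_le_card_of_injective
    (fun l => ⟨fun k => cyc hN l.1.1 k, admissible_restrict l.1.2 hp hM hNp
      (cyc_periodic_of_iterate_eq hN hσ l.2)⟩) fun a b hab => ?_
  exact Subtype.ext (Subtype.ext (cyc_restrict_injective hM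
    (cyc_periodic_of_iterate_eq hN hσ a.2) (cyc_periodic_of_iterate_eq hN hσ b.2)
    (congrArg Subtype.val hab)))

include hN in
/-- A tuple which is not in a free orbit is fixed by `σ^[N / p]` for an odd prime `p ∣ N`. -/
lemma exists_prime_fixed {l : {lam : Fin N → ℕ // Admissible N lam}} {k : ℕ}
    (hk : k ∈ Ioo 0 N) (hl : σ^[k] l = l) :
    ∃ p ∈ N.primeFactors.filter (fun p => Odd p), σ^[N / p] l = l := by
  rw [mem_Ioo] at hk
  have hdN : minimalPeriod σ l ∣ N := IsPeriodicPt.minimalPeriod_dvd (by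
    simp [IsPeriodicPt, IsFixedPt, iterate_shift_eq_id hN hσ])
  have hdk : minimalPeriod σ l ≤ k := IsPeriodicPt.minimalPeriod_le hk.1 hl
  obtain ⟨e, he⟩ := hdN
  have he1 : e ≠ 1 := by rintro rfl; omega
  obtain ⟨p, hp, f, rfl⟩ := Nat.exists_prime_and_dvd he1
  have hNp : N = p * (minimalPeriod σ l * f) := he.trans (by ring)
  have hdiv : N / p = minimalPeriod σ l * f :=
    Nat.div_eq_of_eq_mul_right hp.pos hNp
  have hfix : σ^[N / p] l = l := by
    rw [hdiv]
    exact isPeriodicPt_iff_minimalPeriod_dvd.2 (dvd_mul_right _ _)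
  refine ⟨p, mem_filter.2 ⟨Nat.mem_primeFactors.2 ⟨hp, ⟨_, hNp⟩, hN.ne'⟩, ?_⟩, hfix⟩
  refine hp.odd_of_ne_two ?_
  rintro rfl
  exact not_periodic_half (hN := hN) l.2 (hNp.trans (by rw [hdiv]))
    (cyc_periodic_of_iterate_eq hN hσ hfix)

end Shift

/-- every universe is populated: for every integer `m`,
`N · dim_ℂ eigenspace(P_σ, exp(2πi m/N)) ≥ 2^(N-1) − ∑_{p odd prime, p ∣ N} 2^(N/p − 1)`,
where `P_σ` is the pullback of the cyclic shift `σ` acting on complex-valued functions on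
the set of admissible `N`-tuples. -/
theorem eigenspace_dim_lower_bound (N : ℕ) (hN : 1 ≤ N) (m : ℤ)
    (σ : {lam : Fin N → ℕ // Admissible N lam} → {lam : Fin N → ℕ // Admissible N lam})
    (hσ : ∀ l, (σ l : Fin N → ℕ) = shift N l) :
    (2 : ℤ) ^ (N - 1) -
        ∑ p ∈ N.primeFactors.filter (fun p => Odd p), (2 : ℤ) ^ (N / p - 1)
      ≤ (N : ℤ) * Module.finrank ℂ
          (Module.End.eigenspace (LinearMap.funLeft ℂ ℂ σ)
            (Complex.exp (2 * Real.pi * Complex.I * m / N))) := by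
  classical
  have := finite_admissible hN
  have := Fintype.ofFinite {lam : Fin N → ℕ // Admissible N lam}
  have hω : Complex.exp (2 * Real.pi * Complex.I * m / N) ^ N = 1 := by
    have hNC : (N : ℂ) ≠ 0 := by exact_mod_cast (show N ≠ 0 by omega)
    rw [← Complex.exp_nat_mul, mul_div_cancel₀ _ hNC, Complex.exp_eq_one_iff]
    exact ⟨m, by ring⟩
  have hfree := card_free_le_mul_finrank_eigenspace σ (by omega) (iterate_shift_eq_id hN hσ) hω
    (F := univ.filter fun l => ∀ k ∈ Ioo 0 N, σ^[k] l ≠ l) fun l hl => by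
      simpa using hl
  set P := N.primeFactors.filter (fun p => Odd p)
  have hcover : (univ : Finset {lam : Fin N → ℕ // Admissible N lam}) ⊆
      univ.filter (fun l => ∀ k ∈ Ioo 0 N, σ^[k] l ≠ l) ∪
        P.biUnion fun p => {l | σ^[N / p] l = l} := by
    intro l _
    simp only [mem_union, mem_filter, mem_univ, true_and, mem_biUnion]
    by_contra! h
    obtain ⟨⟨k, hk, hl⟩, h2⟩ := h
    obtain ⟨p, hp, hpl⟩ := exists_prime_fixed hN hσ hk hl
    exact h2 p hp hpl
  have hfixed : ∀ p ∈ P, #{l | σ^[N / p] l = l} ≤ 2 ^ (N / p - 1) := by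
    intro p hp
    obtain ⟨hp1, hodd⟩ := mem_filter.1 hp
    have := card_fixed_le hN hσ hodd
      (Nat.mul_div_cancel' (Nat.dvd_of_mem_primeFactors hp1)).symm
    rwa [Nat.card_eq_fintype_card, Fintype.card_subtype] at this
  have hcount := (card_le_card hcover).trans ((card_union_le _ _).trans
    (add_le_add hfree (card_biUnion_le.trans (sum_le_sum hfixed))))
  rw [card_univ, ← Nat.card_eq_fintype_card, card_admissible hN] at hcount
  rw [sub_le_iff_le_add]
  exact_mod_cast hcount
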